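/- Let D(t) = (1/4096)(t² − 1)(4t² − 1)²(16t² + 20t + 13)² and let f ∈ ℂ((t⁻¹)) be the square root of D with leading term t⁵. Then every convergent (p, q) of f has partial-quotient degree at most 2, i.e. ord(p − q f) ≤ deg q + 2, and there are infinitely many convergents (p, q) of f with q monic whose partial-quotient degree is exactly 2. (Thus the sequence of degrees of the partial quotients of the continued fraction of f is 5, 1, 2, 1, 2, ….) -/

import Mathlib

/-- The element `t` of `ℂ((t⁻¹))`: we model `ℂ((t⁻¹))` as the field `LaurentSeries ℂ` of formal
Laurent series in the variable `X = t⁻¹`, so `t` is the inverse of the variable,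
i.e. the Hahn series `X⁻¹`. -/
noncomputable def tK : LaurentSeries ℂ := HahnSeries.single (-1 : ℤ) 1

/-- The embedding `ℂ[t] → ℂ((t⁻¹))`, sending a polynomial `p` to `p(t)`. -/
noncomputable def emb (p : Polynomial ℂ) : LaurentSeries ℂ := Polynomial.aeval tK p

/-- `ord(h)` = the order of vanishing at infinity: for `h = Σ_{n ≤ n₀} c_n tⁿ` nonzero it is
`−max{n : c_n ≠ 0}`, i.e. the Hahn-series order (least exponent of `t⁻¹` in the support),
and `ord 0 = ⊤`. -/
noncomputable def ordE (h : LaurentSeries ℂ) : WithTop ℤ :=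
  letI := Classical.propDecidable (h = 0)
  if h = 0 then ⊤ else (h.order : WithTop ℤ)

/-- `(p, q)` is a convergent of `f`: `p, q` are coprime polynomials, `q ≠ 0`, and
`ord(p − q f) ≥ deg q + 1`. -/
def IsConvergent (f : LaurentSeries ℂ) (p q : Polynomial ℂ) : Prop :=
  q ≠ 0 ∧ IsCoprime p q ∧
    (((q.natDegree : ℤ) + 1 : ℤ) : WithTop ℤ) ≤ ordE (emb p - emb q * f)

open Polynomial

/-- The order of vanishing at infinity as an additive valuation on `ℂ((t⁻¹))`. -/
noncomputable abbrev ordV : AddValuation (LaurentSeries ℂ) (WithTop ℤ) :=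
  HahnSeries.addVal ℤ ℂ

theorem ordE_eq_ordV (h : LaurentSeries ℂ) : ordE h = ordV h := by
  unfold ordE
  split_ifs with h0
  · simp [h0]
  · rw [HahnSeries.addVal_apply_of_ne h0]

theorem emb_eq_sum (p : ℂ[X]) :
    emb p = ∑ i ∈ Finset.range (p.natDegree + 1), HahnSeries.single (-(i : ℤ)) (p.coeff i) := by
  have h : ∀ c : ℂ, algebraMap ℂ (LaurentSeries ℂ) c = HahnSeries.single 0 c := by
    intro c
    simp [HahnSeries.algebraMap_apply']
  rw [emb, aeval_def, eval₂_eq_sum_range]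
  refine Finset.sum_congr rfl fun i _ => ?_
  rw [h, tK, HahnSeries.single_pow, HahnSeries.single_mul_single]
  simp

theorem emb_coeff_neg (p : ℂ[X]) (n : ℕ) : (emb p).coeff (-(n : ℤ)) = p.coeff n := by
  simp only [emb_eq_sum, HahnSeries.coeff_sum, HahnSeries.coeff_single, neg_inj, Nat.cast_inj,
    Finset.sum_ite_eq, Finset.mem_range]
  split_ifs with h
  · rfl
  · exact (coeff_eq_zero_of_natDegree_lt (by omega)).symm

theorem neg_natDegree_le_ordV_emb (p : ℂ[X]) :
    ((-(p.natDegree : ℤ) : ℤ) : WithTop ℤ) ≤ ordV (emb p) := by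
  rw [emb_eq_sum]
  refine AddValuation.map_le_sum _ fun i hi => ?_
  have hi' : i ≤ p.natDegree := by simpa [Nat.lt_succ_iff] using hi
  rw [HahnSeries.addVal_apply]
  refine le_trans ?_ HahnSeries.orderTop_single_le
  exact_mod_cast (by omega : -(p.natDegree : ℤ) ≤ -i)

theorem ordV_emb {p : ℂ[X]} (hp : p ≠ 0) :
    ordV (emb p) = ((-(p.natDegree : ℤ) : ℤ) : WithTop ℤ) := by
  refine le_antisymm (HahnSeries.addVal_le_of_coeff_ne_zero ?_) (neg_natDegree_le_ordV_emb p)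
  rw [emb_coeff_neg]
  simpa using hp

theorem emb_eq_zero_of_ordV_pos {p : ℂ[X]} (h : 0 < ordV (emb p)) : p = 0 := by
  by_contra hp
  rw [ordV_emb hp] at h
  have : (0 : ℤ) < -(p.natDegree : ℤ) := by exact_mod_cast h
  omega

/-- The polynomials `(Tₙ, Uₙ₋₁)` with `(y + v)ⁿ = Tₙ(y) + Uₙ₋₁(y) v` whenever `v² = y² - 1`. -/
noncomputable def pellPair : ℕ → ℂ[X] × ℂ[X]
  | 0 => (1, 0)
  | n + 1 => (X * (pellPair n).1 + (X ^ 2 - 1) * (pellPair n).2,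
      (pellPair n).1 + X * (pellPair n).2)

theorem pellPair_norm (n : ℕ) :
    (pellPair n).1 ^ 2 - (X ^ 2 - 1) * (pellPair n).2 ^ 2 = 1 := by
  induction n with
  | zero => simp [pellPair]
  | succ n ih =>
    simp only [pellPair]
    linear_combination ih

theorem aeval_pellPair_add {K : Type*} [CommRing K] [Algebra ℂ K] {y v : K}
    (hv : v ^ 2 = y ^ 2 - 1) (n : ℕ) :
    aeval y (pellPair n).1 + aeval y (pellPair n).2 * v = (y + v) ^ n := by
  induction n with
  | zero => simp [pellPair]
  | succ n ih =>
    rw [pow_succ, ← ih]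
    simp only [pellPair, map_add, map_mul, map_sub, map_pow, map_one, aeval_X]
    linear_combination (- aeval y (pellPair n).2) * hv

theorem aeval_pellPair_sub {K : Type*} [CommRing K] [Algebra ℂ K] {y v : K}
    (hv : v ^ 2 = y ^ 2 - 1) (n : ℕ) :
    aeval y (pellPair n).1 - aeval y (pellPair n).2 * v = (y - v) ^ n := by
  have h := aeval_pellPair_add (y := y) (v := -v) (by rw [neg_sq, hv]) n
  rw [sub_eq_add_neg y v, ← h]
  ring

theorem eval_pellPair_snd (n : ℕ) :
    (pellPair n).2.eval (65 / 16 : ℂ) = 8 / 63 * (8 ^ n - (1 / 8) ^ n) := by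
  have hv : (63 / 16 : ℂ) ^ 2 = (65 / 16) ^ 2 - 1 := by norm_num
  have h1 := aeval_pellPair_add hv n
  have h2 := aeval_pellPair_sub hv n
  norm_num [coe_aeval_eq_eval] at h1 h2 ⊢
  linear_combination 8 / 63 * h1 - 8 / 63 * h2

/-- The coefficient `α` for which `α Uₙ + Uₙ₋₁` vanishes at `65 / 16`. -/
theorem exists_pell_combination (n : ℕ) : ∃ α : ℂ, α ≠ 0 ∧ α ^ 2 ≠ 1 ∧
    (C α * (pellPair (n + 2)).2 + (pellPair (n + 1)).2).eval (65 / 16 : ℂ) = 0 := by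
  have hx : (64 : ℂ) ^ n ≠ 0 := pow_ne_zero _ (by norm_num)
  set x : ℂ := 64 ^ n with hxdef
  have h8 : (8 : ℂ) ^ n ≠ 0 := pow_ne_zero _ (by norm_num)
  have hx8 : x = 8 ^ n * 8 ^ n := by rw [hxdef, ← mul_pow]; norm_num
  have hnat : ∀ a b : ℕ, a * 64 ^ n ≠ b → (a : ℂ) * x - b ≠ 0 := by
    intro a b hab h
    apply hab
    have : (a : ℂ) * 64 ^ n = b := by linear_combination h
    exact_mod_cast this
  have hpos : 1 ≤ 64 ^ n := Nat.one_le_pow _ _ (by norm_num)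
  have e1 : (4096 : ℂ) * x - 1 ≠ 0 := by exact_mod_cast hnat 4096 1 (by omega)
  have e2 : (64 : ℂ) * x - 1 ≠ 0 := by exact_mod_cast hnat 64 1 (by omega)
  have e3 : (512 : ℂ) * x - 1 ≠ 0 := by exact_mod_cast hnat 512 1 (by omega)
  have e4 : (512 : ℂ) * x + 1 ≠ 0 := by
    rw [hxdef]; exact_mod_cast (by positivity : (512 * 64 ^ n + 1 : ℕ) ≠ 0)
  refine ⟨-(8 * (64 * x - 1)) / (4096 * x - 1), ?_, ?_, ?_⟩
  · exact div_ne_zero (by simpa using e2) e1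
  · intro h
    rw [div_pow, div_eq_one_iff_eq (pow_ne_zero 2 e1)] at h
    have : 63 * (((512 : ℂ) * x - 1) * (512 * x + 1)) = 0 := by linear_combination -h
    simp [e3, e4] at this
  · simp only [eval_add, eval_mul, eval_C, eval_pellPair_snd]
    rw [div_mul_eq_mul_div, div_add' _ _ _ e1, div_eq_zero_iff]
    left
    rw [hx8, one_div, inv_pow, inv_pow]
    field_simp
    ring

theorem isCoprime_of_sq_sub_mul_sq {P Q D : ℂ[X]} {α : ℂ} (hα : α ≠ 0) (hα1 : α ^ 2 ≠ 1)
    (h : P ^ 2 - D * Q ^ 2 = C (α ^ 2 + 1) + C (2 * α) * (4 * X ^ 3 - 3 * X)) :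
    IsCoprime P Q := by
  rw [Polynomial.isCoprime_iff_aeval_ne_zero_of_isAlgClosed ℂ ℂ]
  intro t
  by_contra! hc
  obtain ⟨hP, hQ⟩ := hc
  rw [coe_aeval_eq_eval] at hP hQ
  have h0 := congrArg (eval t) h
  have h1 := congrArg (fun p => eval t (derivative p)) h
  simp [hP, hQ, derivative_pow] at h0 h1
  have h4 : (2 * t - 1) * (2 * t + 1) = 0 := by
    linear_combination (h1.resolve_left hα) / 3
  apply hα1
  rcases mul_eq_zero.1 h4 with h5 | h5
  · have ht : t = 1 / 2 := by linear_combination h5 / 2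
    rw [ht] at h0
    have : (α - 1) ^ 2 = 0 := by linear_combination -h0
    rw [sub_eq_zero.1 (pow_eq_zero_iff two_ne_zero |>.1 this)]; norm_num
  · have ht : t = -1 / 2 := by linear_combination h5 / 2
    rw [ht] at h0
    have : (α + 1) ^ 2 = 0 := by linear_combination -h0
    rw [eq_neg_of_add_eq_zero_left (pow_eq_zero_iff two_ne_zero |>.1 this)]; norm_num

theorem ordV_mul {x y : LaurentSeries ℂ} {a b : ℤ} (hx : ordV x = (a : WithTop ℤ))
    (hy : ordV y = (b : WithTop ℤ)) : ordV (x * y) = ((a + b : ℤ) : WithTop ℤ) := by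
  rw [AddValuation.map_mul, hx, hy, WithTop.coe_add]

theorem ordV_right_of_mul {x y : LaurentSeries ℂ} {a c : ℤ} (hx : ordV x = (a : WithTop ℤ))
    (hxy : ordV (x * y) = (c : WithTop ℤ)) : ordV y = ((c - a : ℤ) : WithTop ℤ) := by
  rw [AddValuation.map_mul, hx] at hxy
  cases hy : ordV y with
  | top => simp [hy] at hxy
  | coe b =>
    rw [hy] at hxy
    norm_cast at hxy ⊢
    omega

theorem ordV_pow {x : LaurentSeries ℂ} {a : ℤ} (hx : ordV x = (a : WithTop ℤ)) (n : ℕ) :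
    ordV (x ^ n) = ((n * a : ℤ) : WithTop ℤ) := by
  induction n with
  | zero => simp
  | succ n ih =>
    rw [pow_succ, ordV_mul ih hx]
    exact WithTop.coe_inj.2 (by push_cast; ring)

theorem emb_mul (p q : ℂ[X]) : emb (p * q) = emb p * emb q := map_mul _ _ _

theorem emb_add (p q : ℂ[X]) : emb (p + q) = emb p + emb q := map_add _ _ _

theorem emb_sub (p q : ℂ[X]) : emb (p - q) = emb p - emb q := map_sub _ _ _

theorem emb_comp (p q : ℂ[X]) : emb (p.comp q) = aeval (emb q) p := aeval_comp _

theorem emb_C (c : ℂ) : emb (C c) = algebraMap ℂ (LaurentSeries ℂ) c := aeval_C _ _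

theorem ordV_emb_C {c : ℂ} (hc : c ≠ 0) : ordV (emb (C c)) = ((0 : ℤ) : WithTop ℤ) := by
  rw [ordV_emb (C_ne_zero.2 hc)]
  simp

theorem pellPair_succ_mul (n : ℕ) : (pellPair (n + 1)).1 * (pellPair n).1 -
    (X ^ 2 - 1) * ((pellPair (n + 1)).2 * (pellPair n).2) = X := by
  have h := pellPair_norm n
  simp only [pellPair]
  linear_combination X * h

/-- The series `f` is a polynomial multiple of a square root `v` of `T₃² - 1`; we also compute the
orders of the Pell unit `T₃ + v` and of its inverse. -/
theorem exists_pell_unit {f : LaurentSeries ℂ}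
    (hf2 : f ^ 2 = emb ((C (1 / 64 : ℂ) * (16 * X ^ 2 + 20 * X + 13)) ^ 2 *
      ((4 * X ^ 3 - 3 * X) ^ 2 - 1)))
    (hlead : f.coeff (-5 : ℤ) = 1) :
    ∃ v : LaurentSeries ℂ, v ^ 2 = emb (4 * X ^ 3 - 3 * X) ^ 2 - 1 ∧
      f = emb (C (1 / 64 : ℂ) * (16 * X ^ 2 + 20 * X + 13)) * v ∧
      ordV f = ((-5 : ℤ) : WithTop ℤ) ∧
      ordV (emb (4 * X ^ 3 - 3 * X) + v) = ((-3 : ℤ) : WithTop ℤ) ∧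
      ordV (emb (4 * X ^ 3 - 3 * X) - v) = ((3 : ℤ) : WithTop ℤ) := by
  set E : ℂ[X] := C (1 / 64 : ℂ) * (16 * X ^ 2 + 20 * X + 13) with hE
  set T : ℂ[X] := 4 * X ^ 3 - 3 * X with hT
  have hEdeg : E.natDegree = 2 := by rw [hE]; compute_degree!
  have hE0 : E ≠ 0 := by rintro h; simp [h] at hEdeg
  have hVE : ordV (emb E) = ((-2 : ℤ) : WithTop ℤ) := by rw [ordV_emb hE0, hEdeg]; rfl
  have hemb0 : emb E ≠ 0 := by
    intro h
    rw [h, AddValuation.map_zero] at hVE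
    exact WithTop.top_ne_coe hVE
  have hDdeg : (E ^ 2 * (T ^ 2 - 1)).natDegree ≤ 10 := by rw [hE, hT]; compute_degree
  have hETdeg : (E * T).natDegree ≤ 5 := by rw [hE, hT]; compute_degree
  have hETcoeff : (E * T).coeff 5 = 1 := by
    rw [hE, hT]; compute_degree!
  have hVf_le : ordV f ≤ ((-5 : ℤ) : WithTop ℤ) :=
    HahnSeries.addVal_le_of_coeff_ne_zero (by rw [hlead]; exact one_ne_zero)
  have hVf : ordV f = ((-5 : ℤ) : WithTop ℤ) := by
    have h := neg_natDegree_le_ordV_emb (E ^ 2 * (T ^ 2 - 1))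
    rw [← hf2, pow_two f, AddValuation.map_mul] at h
    cases hv : ordV f with
    | top => simp [hv] at hVf_le
    | coe b =>
      rw [hv] at h hVf_le
      norm_cast at h hVf_le ⊢
      omega
  have hv2 : (f / emb E) ^ 2 = emb T ^ 2 - 1 := by
    have h : emb (E ^ 2 * (T ^ 2 - 1)) = emb E ^ 2 * (emb T ^ 2 - 1) := by
      simp [emb]
    rw [div_pow, hf2, h, mul_div_cancel_left₀ _ (pow_ne_zero 2 hemb0)]
  have hfv : f = emb E * (f / emb E) := by field_simp
  have hsum : ordV (emb E * (emb T + f / emb E)) = ((-5 : ℤ) : WithTop ℤ) := by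
    rw [mul_add, ← hfv, ← emb_mul]
    refine le_antisymm (HahnSeries.addVal_le_of_coeff_ne_zero ?_)
      (AddValuation.map_le_add _ ?_ hVf.ge)
    · have := emb_coeff_neg (E * T) 5
      rw [HahnSeries.coeff_add, hlead]
      erw [this]
      rw [hETcoeff]
      norm_num
    · refine le_trans ?_ (neg_natDegree_le_ordV_emb _)
      exact_mod_cast (by omega)
  have hZ := ordV_right_of_mul hVE hsum
  refine ⟨f / emb E, hv2, hfv, hVf, hZ, ?_⟩
  refine ordV_right_of_mul hZ (c := 0) ?_
  have : (emb T + f / emb E) * (emb T - f / emb E) = 1 := by linear_combination -hv2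
  rw [this, AddValuation.map_one]
  rfl

theorem exists_isCoprime_ordV_eq {f : LaurentSeries ℂ}
    (hf2 : f ^ 2 = emb ((C (1 / 64 : ℂ) * (16 * X ^ 2 + 20 * X + 13)) ^ 2 *
      ((4 * X ^ 3 - 3 * X) ^ 2 - 1)))
    (hlead : f.coeff (-5 : ℤ) = 1) (n : ℕ) :
    ∃ P Q : ℂ[X], Q ≠ 0 ∧ Q.natDegree = 3 * n + 1 ∧ IsCoprime P Q ∧
      ordV (emb P - emb Q * f) = ((3 * n + 3 : ℤ) : WithTop ℤ) := by
  obtain ⟨v, hv2, hfv, hVf, hZ, hW⟩ := exists_pell_unit hf2 hlead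
  obtain ⟨α, hα, hα1, hroot⟩ := exists_pell_combination n
  obtain ⟨R, hR⟩ := dvd_iff_isRoot.2 hroot
  set E : ℂ[X] := C (1 / 64 : ℂ) * (16 * X ^ 2 + 20 * X + 13) with hE
  set T : ℂ[X] := 4 * X ^ 3 - 3 * X with hT
  set P : ℂ[X] := (C α * (pellPair (n + 2)).1 + (pellPair (n + 1)).1).comp T with hP
  set Q : ℂ[X] := 4 * (4 * X - 5) * R.comp T with hQ
  have hTE : T - C (65 / 16) = 4 * (4 * X - 5) * E := by
    have h1 : (C (1 / 64 : ℂ) : ℂ[X]) * 64 = 1 := by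
      rw [← C_ofNat, ← C_mul]; norm_num
    have h2 : (C (65 / 16 : ℂ) : ℂ[X]) = C (1 / 64 : ℂ) * 260 := by
      rw [← C_ofNat, ← C_mul]; norm_num
    rw [hE, hT, h2]
    linear_combination (-(4 * X ^ 3 - 3 * X)) * h1
  have hQE : Q * E = (C α * (pellPair (n + 2)).2 + (pellPair (n + 1)).2).comp T := by
    rw [hR, mul_comp, sub_comp, X_comp, C_comp, hTE, hQ]
    ring
  have hnorm : P ^ 2 - (E ^ 2 * (T ^ 2 - 1)) * Q ^ 2 = C (α ^ 2 + 1) + C (2 * α) * T := by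
    have h : (C α * (pellPair (n + 2)).1 + (pellPair (n + 1)).1) ^ 2 -
        (X ^ 2 - 1) * (C α * (pellPair (n + 2)).2 + (pellPair (n + 1)).2) ^ 2 =
        C (α ^ 2 + 1) + C (2 * α) * X := by
      simp only [C_add, C_mul, C_pow, C_1, C_ofNat]
      linear_combination C α ^ 2 * pellPair_norm (n + 2) + pellPair_norm (n + 1) +
        2 * C α * pellPair_succ_mul (n + 1)
    have h' := congrArg (fun p => p.comp T) h
    simp only [sub_comp, mul_comp, pow_comp, X_comp, one_comp] at h'
    have hlin : (C (α ^ 2 + 1) + C (2 * α) * X).comp T = C (α ^ 2 + 1) + C (2 * α) * T := by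
      rw [add_comp, mul_comp, C_comp, C_comp, X_comp]
    rw [hP]
    linear_combination h' + hlin + (-(T ^ 2 - 1)) * congrArg (fun p => p ^ 2) hQE
  have hQf : emb Q * f =
      aeval (emb T) (C α * (pellPair (n + 2)).2 + (pellPair (n + 1)).2) * v := by
    rw [hfv, ← mul_assoc, ← emb_mul, hQE, emb_comp]
  have hPT : emb P = aeval (emb T) (C α * (pellPair (n + 2)).1 + (pellPair (n + 1)).1) := by
    rw [hP, emb_comp]
  have hsub : emb P - emb Q * f = (emb T - v) ^ (n + 1) * (emb (C α) * (emb T - v) + 1) := by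
    have h1 := aeval_pellPair_sub hv2 (n + 1)
    have h2 := aeval_pellPair_sub hv2 (n + 2)
    rw [hPT, hQf, emb_C]
    simp only [map_add, map_mul, aeval_C]
    linear_combination algebraMap ℂ (LaurentSeries ℂ) α * h2 + h1
  have hadd : emb P + emb Q * f = (emb T + v) ^ (n + 1) * (emb (C α) * (emb T + v) + 1) := by
    have h1 := aeval_pellPair_add hv2 (n + 1)
    have h2 := aeval_pellPair_add hv2 (n + 2)
    rw [hPT, hQf, emb_C]
    simp only [map_add, map_mul, aeval_C]
    linear_combination algebraMap ℂ (LaurentSeries ℂ) α * h2 + h1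
  have hone : ordV (1 : LaurentSeries ℂ) = ((0 : ℤ) : WithTop ℤ) := AddValuation.map_one _
  have hVsub : ordV (emb P - emb Q * f) = ((3 * n + 3 : ℤ) : WithTop ℤ) := by
    have h1 := ordV_mul (ordV_emb_C hα) hW
    have h2 : ordV (emb (C α) * (emb T - v) + 1) = ((0 : ℤ) : WithTop ℤ) := by
      rw [AddValuation.map_add_eq_of_lt_right _ (by rw [hone, h1]; exact_mod_cast (by norm_num)),
        hone]
    rw [hsub, ordV_mul (ordV_pow hW (n + 1)) h2]
    exact WithTop.coe_inj.2 (by push_cast; ring)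
  have hVadd : ordV (emb P + emb Q * f) = ((-(3 * n) - 6 : ℤ) : WithTop ℤ) := by
    have h1 := ordV_mul (ordV_emb_C hα) hZ
    have h2 : ordV (emb (C α) * (emb T + v) + 1) = ((-3 : ℤ) : WithTop ℤ) := by
      rw [AddValuation.map_add_eq_of_lt_left _ (by rw [hone, h1]; exact_mod_cast (by norm_num)),
        h1]
      rfl
    rw [hadd, ordV_mul (ordV_pow hZ (n + 1)) h2]
    exact WithTop.coe_inj.2 (by push_cast; ring)
  have hV2 : ordV (f * emb (C 2 * Q)) = ((-(3 * n) - 6 : ℤ) : WithTop ℤ) := by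
    have h : f * emb (C 2 * Q) = (emb P + emb Q * f) - (emb P - emb Q * f) := by
      rw [emb_mul, emb_C, map_ofNat]
      ring
    rw [h, AddValuation.map_sub_eq_of_lt_left _ (by
      rw [hVadd, hVsub]; exact_mod_cast (by omega)), hVadd]
  have hVQ := ordV_right_of_mul hVf hV2
  have hQ0 : Q ≠ 0 := by
    rintro h
    rw [h, mul_zero, emb, map_zero, AddValuation.map_zero] at hVQ
    exact WithTop.top_ne_coe hVQ
  refine ⟨P, Q, hQ0, ?_, isCoprime_of_sq_sub_mul_sq hα hα1 hnorm, hVsub⟩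
  rw [ordV_emb (mul_ne_zero (C_ne_zero.2 two_ne_zero) hQ0), natDegree_C_mul two_ne_zero] at hVQ
  norm_cast at hVQ
  omega

/-- If a coprime pair `(P, Q)` with `deg Q ≡ 1 mod 3` and order `deg Q + 2` exists in every such
degree, no pair `(p, q)` approximates `f` to order more than `deg q + 2`. -/
theorem ordV_le_natDegree_add_two {f : LaurentSeries ℂ}
    (hconv : ∀ n : ℕ, ∃ P Q : ℂ[X], Q ≠ 0 ∧ Q.natDegree = 3 * n + 1 ∧ IsCoprime P Q ∧
      ordV (emb P - emb Q * f) = ((3 * n + 3 : ℤ) : WithTop ℤ))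
    {p q : ℂ[X]} (hq : q ≠ 0) :
    ordV (emb p - emb q * f) ≤ ((q.natDegree + 2 : ℤ) : WithTop ℤ) := by
  by_contra! hlt
  obtain ⟨P, Q, hQ, hdeg, hcop, hV⟩ := hconv ((q.natDegree + 1) / 3)
  have hVQ := ordV_emb hQ
  have hVq := ordV_emb hq
  have hzero : p * Q - q * P = 0 := by
    apply emb_eq_zero_of_ordV_pos
    have h : emb (p * Q - q * P) =
        emb Q * (emb p - emb q * f) - emb q * (emb P - emb Q * f) := by
      rw [emb_sub, emb_mul, emb_mul]
      ring
    rw [h, sub_eq_add_neg]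
    refine AddValuation.map_lt_add _ ?_ ?_
    · rw [AddValuation.map_mul, hVQ]
      cases hv : ordV (emb p - emb q * f) with
      | top => simp
      | coe b =>
        rw [hv] at hlt
        norm_cast at hlt ⊢
        omega
    · rw [AddValuation.map_neg, ordV_mul hVq hV]
      norm_cast
      omega
  have hdvd : Q ∣ q := by
    refine hcop.symm.dvd_of_dvd_mul_right ⟨p, ?_⟩
    linear_combination -hzero
  obtain ⟨c, rfl⟩ := hdvd
  have hp : p = c * P := by
    apply mul_right_cancel₀ hQ
    linear_combination hzero
  have hc : c ≠ 0 := right_ne_zero_of_mul hq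
  have h : emb p - emb (Q * c) * f = emb c * (emb P - emb Q * f) := by
    rw [hp, emb_mul, emb_mul]
    ring
  rw [h, ordV_mul (ordV_emb hc) hV, natDegree_mul hQ hc] at hlt
  rw [natDegree_mul hQ hc] at hdeg
  norm_cast at hlt
  omega

theorem exists_monic_of_isCoprime {f : LaurentSeries ℂ} {m : ℕ} {a : ℤ}
    (h : ∃ P Q : ℂ[X], Q ≠ 0 ∧ Q.natDegree = m ∧ IsCoprime P Q ∧
      ordV (emb P - emb Q * f) = (a : WithTop ℤ)) :
    ∃ P Q : ℂ[X], Q.Monic ∧ Q.natDegree = m ∧ IsCoprime P Q ∧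
      ordV (emb P - emb Q * f) = (a : WithTop ℤ) := by
  obtain ⟨P, Q, hQ, hdeg, hcop, hV⟩ := h
  have hc : Q.leadingCoeff⁻¹ ≠ 0 := inv_ne_zero (leadingCoeff_ne_zero.2 hQ)
  refine ⟨C Q.leadingCoeff⁻¹ * P, C Q.leadingCoeff⁻¹ * Q, ?_, ?_, ?_, ?_⟩
  · rw [mul_comm]
    exact monic_mul_leadingCoeff_inv hQ
  · rw [natDegree_C_mul hc, hdeg]
  · exact (isCoprime_mul_unit_left (isUnit_C.2 hc.isUnit) P Q).2 hcop
  · rw [emb_mul, emb_mul, mul_assoc, ← mul_sub, ordV_mul (ordV_emb_C hc) hV, zero_add]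

/-- For `D(t) = (1/4096)(t² − 1)(4t² − 1)²(16t² + 20t + 13)²`, every partial quotient of
`√D` has degree at most `2`, and infinitely many have degree exactly `2`. -/
theorem stmt17 (D : Polynomial ℂ)
    (hD : D = Polynomial.C (1 / 4096 : ℂ) * (Polynomial.X ^ 2 - 1) *
      (4 * Polynomial.X ^ 2 - 1) ^ 2 *
      (16 * Polynomial.X ^ 2 + 20 * Polynomial.X + 13) ^ 2)
    (f : LaurentSeries ℂ) (hf2 : f ^ 2 = emb D) (hlead : f.coeff (-5 : ℤ) = 1) :
    (∀ p q : Polynomial ℂ, IsConvergent f p q →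
      ordE (emb p - emb q * f) ≤ (((q.natDegree : ℤ) + 2 : ℤ) : WithTop ℤ)) ∧
    {pq : Polynomial ℂ × Polynomial ℂ | IsConvergent f pq.1 pq.2 ∧ pq.2.Monic ∧
      ordE (emb pq.1 - emb pq.2 * f) =
        (((pq.2.natDegree : ℤ) + 2 : ℤ) : WithTop ℤ)}.Infinite := by
  have hD' : D = (C (1 / 64 : ℂ) * (16 * X ^ 2 + 20 * X + 13)) ^ 2 *
      ((4 * X ^ 3 - 3 * X) ^ 2 - 1) := by
    have h : (C (1 / 4096 : ℂ) : ℂ[X]) = C (1 / 64) ^ 2 := by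
      rw [← C_pow]; norm_num
    rw [hD, h]
    ring
  rw [hD'] at hf2
  have hconv := exists_isCoprime_ordV_eq hf2 hlead
  refine ⟨fun p q hpq => ?_, ?_⟩
  · rw [ordE_eq_ordV]
    exact ordV_le_natDegree_add_two hconv hpq.1
  choose P Q hQ hdeg hcop hV using fun n => exists_monic_of_isCoprime (hconv n)
  refine Set.infinite_of_injective_forall_mem (f := fun n => (P n, Q n)) ?_ ?_
  · intro a b hab
    have h : (Q a).natDegree = (Q b).natDegree := congrArg natDegree (Prod.ext_iff.1 hab).2
    rw [hdeg, hdeg] at h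
    omega
  · intro n
    have hord : ordE (emb (P n) - emb (Q n) * f) =
        (((Q n).natDegree + 2 : ℤ) : WithTop ℤ) := by
      rw [ordE_eq_ordV, hV, hdeg]
      exact WithTop.coe_inj.2 (by push_cast; ring)
    refine ⟨⟨(hQ n).ne_zero, hcop n, ?_⟩, hQ n, hord⟩
    exact hord.symm ▸ WithTop.coe_le_coe.2 (by
      change _ ≤ ((Q n).natDegree : ℤ) + 2
      gcongr
      norm_num)
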